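/- Let g be a Riemannian metric on Ω with Levi-Civita connection form A of class C¹ and curvature R, let x ∈ C²(I, Ω) be a geodesic for A, ξ ∈ C¹(I, V), and τ ∈ I. Suppose H is a collection of Jacobi fields η along x, each defined on a neighborhood J_η ⊆ I of τ, such that η(τ) = 0 for every η ∈ H and the set {η′(τ) : η ∈ H} is dense in V. Then for every η ∈ H the function t ↦ g_{x(t)}(ξ(t), η(t)) is twice differentiable at τ; and ξ′(τ) + A(x(τ))(x′(τ))(ξ(τ)) = 0 holds if and only if (d²/dt²) g_{x(t)}(ξ(t), η(t)) |_{t=τ} = 0 for all η ∈ H. -/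

import Mathlib

open scoped Topology

noncomputable section

/-- A Riemannian metric on `Ω`: a family of symmetric positive definite continuous bilinear
forms. -/
def IsRiemannianMetric {V : Type*} [NormedAddCommGroup V] [NormedSpace ℝ V]
    (Ω : Set V) (g : V → V →L[ℝ] V →L[ℝ] ℝ) : Prop :=
  (∀ v ∈ Ω, ∀ ξ η : V, g v ξ η = g v η ξ) ∧ ∀ v ∈ Ω, ∀ ξ : V, ξ ≠ 0 → 0 < g v ξ ξ

/-- `A` is a Levi-Civita connection form for `g` on `Ω` (torsion-free and compatible). -/
def IsLeviCivita {V : Type*} [NormedAddCommGroup V] [NormedSpace ℝ V]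
    (Ω : Set V) (g : V → V →L[ℝ] V →L[ℝ] ℝ) (A : V → V →L[ℝ] V →L[ℝ] V) : Prop :=
  (∀ v ∈ Ω, ∀ ξ η : V, A v ξ η = A v η ξ) ∧
  ∀ v ∈ Ω, ∀ η ζ : V, HasFDerivAt (fun w => g w η ζ)
    (((g v).flip ζ).comp ((A v).flip η) + ((g v) η).comp ((A v).flip ζ)) v

/-- The curvature of a connection form `A`. -/
def curvature {V W : Type*} [NormedAddCommGroup V] [NormedSpace ℝ V]
    [NormedAddCommGroup W] [NormedSpace ℝ W]
    (A : V → V →L[ℝ] W →L[ℝ] W) (v : V) (ξ η : V) : W →L[ℝ] W :=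
  fderiv ℝ A v ξ η - fderiv ℝ A v η ξ + (A v ξ).comp (A v η) - (A v η).comp (A v ξ)

/-- If `N` has closed sublevel sets on `[a, b]` and boundedness on a subinterval already forces
`N t ≤ 2 * N t'` there, then `N` is bounded on `[a, b]`. -/
theorem bddAbove_image_Icc_of_isClosed_sublevel {N : ℝ → ℝ} {a b : ℝ}
    (hN : ∀ n : ℕ, IsClosed {t ∈ Set.Icc a b | N t ≤ n})
    (h : ∀ r s, a ≤ r → s ≤ b → BddAbove (N '' Set.Icc r s) →
      ∀ t ∈ Set.Icc r s, ∀ t' ∈ Set.Icc r s, N t ≤ 2 * N t') :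
    BddAbove (N '' Set.Icc a b) := by
  set K : Set ℝ := {t ∈ Set.Icc a b | ∀ U ∈ 𝓝 t, ¬ BddAbove (N '' (U ∩ Set.Icc a b))} with hK
  have hbdd : ∀ r s, a ≤ r → s ≤ b → (∀ t ∈ Set.Icc r s, t ∉ K) →
      BddAbove (N '' Set.Icc r s) := by
    intro r s har hsb hrs
    refine (isCompact_Icc (a := r) (b := s)).induction_on
      (p := fun S => BddAbove (N '' S)) (by simp)
      (fun S T hST hT => hT.mono (Set.image_mono hST))
      (fun S T hS hT => by rw [Set.image_union]; exact hS.union hT) ?_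
    intro t ht
    have htab : t ∈ Set.Icc a b := ⟨har.trans ht.1, ht.2.trans hsb⟩
    have := hrs t ht
    simp only [hK, Set.mem_ofPred_eq, not_and, not_forall, not_not] at this
    obtain ⟨U, hU, hb⟩ := this htab
    refine ⟨U ∩ Set.Icc r s, Filter.inter_mem (mem_nhdsWithin_of_mem_nhds hU)
      self_mem_nhdsWithin, hb.mono (Set.image_mono ?_)⟩
    exact Set.inter_subset_inter_right _ (Set.Icc_subset_Icc har hsb)
  have hright : ∀ r s, a ≤ r → s ≤ b → r ≤ s → (∀ t ∈ Set.Ioc r s, t ∉ K) →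
      N s ≤ 2 * N r := by
    intro r s har hsb hrs hnK
    refine h r s har hsb ⟨max (N r) (2 * N s), ?_⟩ s ⟨hrs, le_rfl⟩ r ⟨le_rfl, hrs⟩
    rintro _ ⟨t, ht, rfl⟩
    rcases eq_or_lt_of_le ht.1 with rfl | hlt
    · exact le_max_left _ _
    · refine le_max_of_le_right (h t s (har.trans ht.1) hsb (hbdd t s (har.trans ht.1) hsb ?_)
        t ⟨le_rfl, ht.2⟩ s ⟨ht.2, le_rfl⟩)
      exact fun u hu => hnK u ⟨hlt.trans_le hu.1, hu.2⟩
  have hleft : ∀ r s, a ≤ r → s ≤ b → r ≤ s → (∀ t ∈ Set.Ico r s, t ∉ K) →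
      N r ≤ 2 * N s := by
    intro r s har hsb hrs hnK
    refine h r s har hsb ⟨max (N s) (2 * N r), ?_⟩ r ⟨le_rfl, hrs⟩ s ⟨hrs, le_rfl⟩
    rintro _ ⟨t, ht, rfl⟩
    rcases eq_or_lt_of_le ht.2 with rfl | hlt
    · exact le_max_left _ _
    · refine le_max_of_le_right (h r t har (ht.2.trans hsb) (hbdd r t har (ht.2.trans hsb) ?_)
        t ⟨ht.1, le_rfl⟩ r ⟨le_rfl, ht.1⟩)
      exact fun u hu => hnK u ⟨hu.1, hu.2.trans_lt hlt⟩
  have hKab : K ⊆ Set.Icc a b := fun t ht => ht.1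
  have hKclosed : IsClosed K := by
    rw [← isOpen_compl_iff, isOpen_iff_mem_nhds]
    intro t ht
    by_cases htab : t ∈ Set.Icc a b
    · simp only [hK, Set.mem_compl_iff, Set.mem_ofPred_eq, not_and, not_forall, not_not] at ht
      obtain ⟨U, hU, hb⟩ := ht htab
      filter_upwards [eventually_mem_nhds_iff.2 hU] with u hu huK
      exact huK.2 U hu hb
    · filter_upwards [isClosed_Icc.isOpen_compl.mem_nhds htab] with u hu huK
      exact hu huK.1
  rcases K.eq_empty_or_nonempty with hKe | hKne
  · exact hbdd a b le_rfl le_rfl (by simp [hKe])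
  exfalso
  have : CompleteSpace K := hKclosed.completeSpace_coe
  have : Nonempty K := hKne.to_subtype
  obtain ⟨n, c, hc⟩ := nonempty_interior_of_iUnion_of_closed
    (f := fun n : ℕ => ((↑) : K → ℝ) ⁻¹' {t ∈ Set.Icc a b | N t ≤ n})
    (fun n => (hN n).preimage continuous_subtype_val) (by
      refine Set.eq_univ_of_forall fun t => ?_
      obtain ⟨n, hn⟩ := exists_nat_ge (N t)
      exact Set.mem_iUnion.2 ⟨n, hKab t.2, hn⟩)
  obtain ⟨ε, hε, hball⟩ := Metric.mem_nhds_iff.1 (mem_interior_iff_mem_nhds.1 hc)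
  refine c.2.2 (Metric.ball c ε) (Metric.ball_mem_nhds _ hε) ⟨2 * n, ?_⟩
  rintro _ ⟨s, ⟨hsε, hsab⟩, rfl⟩
  rw [Metric.mem_ball, Real.dist_eq, abs_lt] at hsε
  have hKn : ∀ u ∈ K, |u - c| < ε → N u ≤ n := fun u hu huc =>
    (hball (show (⟨u, hu⟩ : K) ∈ Metric.ball c ε by
      rwa [Metric.mem_ball, Subtype.dist_eq, Real.dist_eq])).2
  rcases le_total (c : ℝ) s with hcs | hsc
  · obtain ⟨u, ⟨huK, hcu, hus⟩, hu⟩ := (isCompact_Icc.inter_left hKclosed).exists_isGreatest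
      ⟨(c : ℝ), c.2, le_rfl, hcs⟩
    have h1 := hright u s (hKab huK).1 hsab.2 hus fun t ht htK =>
      ht.1.not_ge (hu ⟨htK, hcu.trans ht.1.le, ht.2⟩)
    have h2 := hKn u huK (by rw [abs_lt]; constructor <;> linarith)
    linarith
  · obtain ⟨u, ⟨huK, hsu, huc⟩, hu⟩ := (isCompact_Icc.inter_left hKclosed).exists_isLeast
      ⟨(c : ℝ), c.2, hsc, le_rfl⟩
    have h1 := hleft s u hsab.1 (hKab huK).2 hsu fun t ht htK =>
      ht.2.not_ge (hu ⟨htK, ht.1, ht.2.le.trans huc⟩)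
    have h2 := hKn u huK (by rw [abs_lt]; constructor <;> linarith)
    linarith

/-- A function whose distance to `y` is eventually dominated by a function tending to zero
tends to `y`. -/
theorem tendsto_of_norm_sub_le {α E : Type*} [NormedAddCommGroup E] {l : Filter α} {f : α → E}
    {y : E} {u : α → ℝ} (h : ∀ᶠ a in l, ‖f a - y‖ ≤ u a) (hu : Filter.Tendsto u l (𝓝 0)) :
    Filter.Tendsto f l (𝓝 y) :=
  tendsto_iff_norm_sub_tendsto_zero.2
    (squeeze_zero' (Filter.Eventually.of_forall fun _ => norm_nonneg _) h hu)

section ParallelForm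

variable {V : Type*} [NormedAddCommGroup V] [NormedSpace ℝ V]

/-- A pointwise solution of `G' = G(B ·, ·) + G(·, B ·)` is Lipschitz wherever it is bounded. -/
theorem norm_sub_le_of_pointwise_hasDerivWithinAt {S : Set ℝ} (hS : S.OrdConnected)
    {G : ℝ → V →L[ℝ] V →L[ℝ] ℝ} {B : ℝ → V →L[ℝ] V}
    (hG : ∀ t ∈ S, ∀ η ζ : V, HasDerivWithinAt (fun s => G s η ζ)
      (G t (B t η) ζ + G t η (B t ζ)) S t)
    {L M : ℝ} (hL : ∀ t ∈ S, ‖B t‖ ≤ L) (hM : ∀ t ∈ S, ‖G t‖ ≤ M)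
    {r s : ℝ} (hr : r ∈ S) (hs : s ∈ S) : ‖G s - G r‖ ≤ 2 * L * M * |s - r| := by
  have hL0 : 0 ≤ L := (norm_nonneg _).trans (hL r hr)
  have hM0 : 0 ≤ M := (norm_nonneg (G r)).trans (hM r hr)
  refine ContinuousLinearMap.opNorm_le_bound₂ _ (by positivity) fun η ζ => ?_
  have := hS.convex.norm_image_sub_le_of_norm_hasDerivWithin_le (f := fun s => G s η ζ)
    (C := 2 * L * M * ‖η‖ * ‖ζ‖) (fun t ht => hG t ht η ζ) (fun t ht => ?_) hr hs
  · rw [sub_apply, sub_apply]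
    refine this.trans (le_of_eq ?_)
    rw [Real.norm_eq_abs (s - r)]; ring
  · have hB : ∀ v, ‖B t v‖ ≤ L * ‖v‖ := fun v => (B t).le_of_opNorm_le (hL t ht) v
    have h1 : ‖G t (B t η) ζ‖ ≤ M * (L * ‖η‖) * ‖ζ‖ := by
      refine ((G t).le_opNorm₂ _ _).trans ?_
      gcongr
      exacts [hM t ht, hB η]
    have h2 : ‖G t η (B t ζ)‖ ≤ M * ‖η‖ * (L * ‖ζ‖) := by
      refine ((G t).le_opNorm₂ _ _).trans ?_
      gcongr
      exacts [hM t ht, hB ζ]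
    refine (norm_add_le _ _).trans ?_
    linarith

/-- On a short interval, the norms of a pointwise solution of `G' = G(B ·, ·) + G(·, B ·)` with
`B` bounded are comparable up to a factor `2`. -/
theorem norm_le_two_mul_of_pointwise_hasDerivWithinAt {I : Set ℝ} {a b : ℝ}
    (hI : Set.Icc a b ⊆ I) {G : ℝ → V →L[ℝ] V →L[ℝ] ℝ} {B : ℝ → V →L[ℝ] V}
    (hG : ∀ t ∈ I, ∀ η ζ : V, HasDerivWithinAt (fun s => G s η ζ)
      (G t (B t η) ζ + G t η (B t ζ)) I t)
    {L : ℝ} (hL0 : 0 < L) (hBL : ∀ t ∈ Set.Icc a b, ‖B t‖ ≤ L) (hab : b - a ≤ 1 / (4 * L)) :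
    ∀ t ∈ Set.Icc a b, ∀ t' ∈ Set.Icc a b, ‖G t‖ ≤ 2 * ‖G t'‖ := by
  have hstep : ∀ r s, a ≤ r → s ≤ b → BddAbove ((fun t => ‖G t‖) '' Set.Icc r s) →
      ∀ t ∈ Set.Icc r s, ∀ t' ∈ Set.Icc r s, ‖G t‖ ≤ 2 * ‖G t'‖ := by
    intro r s har hsb hbd t ht t' ht'
    have hrs : Set.Icc r s ⊆ Set.Icc a b := Set.Icc_subset_Icc har hsb
    set M := sSup ((fun t => ‖G t‖) '' Set.Icc r s)
    have hM : ∀ u ∈ Set.Icc r s, ‖G u‖ ≤ M := fun u hu => le_csSup hbd ⟨u, hu, rfl⟩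
    have hM0 : 0 ≤ M := (norm_nonneg (G t)).trans (hM t ht)
    have key : M ≤ ‖G t'‖ + M / 2 := by
      refine csSup_le ⟨_, t, ht, rfl⟩ ?_
      rintro _ ⟨u, hu, rfl⟩
      have h1 := norm_sub_le_of_pointwise_hasDerivWithinAt (Set.ordConnected_Icc)
        (fun v hv η ζ => (hG v (hI (hrs hv)) η ζ).mono (hrs.trans hI))
        (fun v hv => hBL v (hrs hv)) hM ht' hu
      have h2 : |u - t'| ≤ 1 / (4 * L) := by
        refine le_trans ?_ hab
        rw [abs_le]
        constructor <;> linarith [hu.1, hu.2, ht'.1, ht'.2]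
      have h3 : 2 * L * M * |u - t'| ≤ M / 2 := by
        calc 2 * L * M * |u - t'| ≤ 2 * L * M * (1 / (4 * L)) := by gcongr
          _ = M / 2 := by field_simp; ring
      have h4 := norm_le_norm_add_norm_sub' (G u) (G t')
      simp only
      linarith
    linarith [hM t ht]
  refine hstep a b le_rfl le_rfl (bddAbove_image_Icc_of_isClosed_sublevel (fun n => ?_) hstep)
  have : {t ∈ Set.Icc a b | ‖G t‖ ≤ n} =
      Set.Icc a b ∩ ⋂ (η : V) (ζ : V), {t ∈ Set.Icc a b | ‖G t η ζ‖ ≤ n * ‖η‖ * ‖ζ‖} := by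
    ext t
    simp only [Set.mem_ofPred_eq, Set.mem_inter_iff, Set.mem_iInter]
    refine and_congr_right fun ht => ⟨fun h η ζ => ⟨ht, ?_⟩, fun h => ?_⟩
    · exact ((G t).le_opNorm₂ η ζ).trans (by gcongr)
    · exact ContinuousLinearMap.opNorm_le_bound₂ _ n.cast_nonneg fun η ζ => (h η ζ).2
  rw [this]
  refine isClosed_Icc.inter (isClosed_iInter fun η => isClosed_iInter fun ζ => ?_)
  refine isClosed_Icc.isClosed_le (ContinuousOn.norm fun t ht => ?_) continuousOn_const
  exact ((hG t (hI ht) η ζ).mono hI).continuousWithinAt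

/-- A pointwise solution of `G' = G(B ·, ·) + G(·, B ·)` with `B` continuous is continuous in
the operator norm, without any completeness of the space. -/
theorem continuousOn_of_pointwise_hasDerivWithinAt {I : Set ℝ} (hI : I.OrdConnected)
    {G : ℝ → V →L[ℝ] V →L[ℝ] ℝ} {B : ℝ → V →L[ℝ] V} (hB : ContinuousOn B I)
    (hG : ∀ t ∈ I, ∀ η ζ : V, HasDerivWithinAt (fun s => G s η ζ)
      (G t (B t η) ζ + G t η (B t ζ)) I t) : ContinuousOn G I := by
  intro t₀ ht₀
  obtain ⟨L, hL⟩ := exists_gt ‖B t₀‖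
  have hL0 : 0 < L := (norm_nonneg (B t₀)).trans_lt hL
  obtain ⟨ε, hε, hεL⟩ : ∃ ε > 0, ∀ t ∈ I, |t - t₀| < ε → ‖B t‖ ≤ L := by
    have : ∀ᶠ t in 𝓝[I] t₀, ‖B t‖ < L :=
      (hB t₀ ht₀).norm.eventually_lt continuousWithinAt_const hL
    obtain ⟨ε, hε, h⟩ := Metric.mem_nhdsWithin_iff.1 this
    exact ⟨ε, hε, fun t ht htε => le_of_lt (h ⟨by rwa [Metric.mem_ball, Real.dist_eq], ht⟩)⟩
  obtain ⟨δ, hδ, hδε, hδL⟩ : ∃ δ > 0, δ ≤ ε ∧ δ ≤ 1 / (4 * L) :=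
    ⟨min ε (1 / (4 * L)), by positivity, min_le_left _ _, min_le_right _ _⟩
  have hbound : ∀ a ∈ I, ∀ b ∈ I, |a - t₀| < δ → |b - t₀| < δ → |b - a| ≤ δ →
      ∀ t ∈ Set.Icc a b, ∀ t' ∈ Set.Icc a b, ‖G t‖ ≤ 2 * ‖G t'‖ := by
    intro a ha b hb haδ hbδ hab
    have hsub : Set.Icc a b ⊆ I := hI.out ha hb
    have hBL : ∀ t ∈ Set.Icc a b, ‖B t‖ ≤ L := fun t ht => by
      refine hεL t (hsub ht) (lt_of_lt_of_le ?_ hδε)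
      rw [abs_lt] at haδ hbδ ⊢
      constructor <;> linarith [ht.1, ht.2]
    exact norm_le_two_mul_of_pointwise_hasDerivWithinAt hsub hG hL0 hBL
      ((le_abs_self _).trans (hab.trans hδL))
  have hS : (I ∩ Metric.ball t₀ δ).OrdConnected :=
    hI.inter (by rw [Real.ball_eq_Ioo]; exact Set.ordConnected_Ioo)
  have hlip : ∀ s ∈ I ∩ Metric.ball t₀ δ,
      ‖G s - G t₀‖ ≤ 2 * L * (2 * ‖G t₀‖) * |s - t₀| := by
    intro s hs
    refine norm_sub_le_of_pointwise_hasDerivWithinAt hS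
      (fun v hv η ζ => (hG v hv.1 η ζ).mono Set.inter_subset_left)
      (fun t ht => hεL t ht.1 (lt_of_lt_of_le ht.2 hδε)) (fun t ht => ?_)
      ⟨ht₀, Metric.mem_ball_self hδ⟩ hs
    have htδ : |t - t₀| < δ := ht.2
    rcases le_total t t₀ with h | h
    · exact hbound t ht.1 t₀ ht₀ htδ (by simpa using hδ) (by rw [abs_sub_comm]; exact htδ.le)
        t ⟨le_rfl, h⟩ t₀ ⟨h, le_rfl⟩
    · exact hbound t₀ ht₀ t ht.1 (by simpa using hδ) htδ htδ.le t ⟨h, le_rfl⟩ t₀ ⟨le_rfl, h⟩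
  have hlim : Filter.Tendsto (fun s => 2 * L * (2 * ‖G t₀‖) * |s - t₀|) (𝓝[I] t₀) (𝓝 0) := by
    generalize 2 * L * (2 * ‖G t₀‖) = C
    have : Continuous fun s : ℝ => C * |s - t₀| := by fun_prop
    simpa using (this.tendsto t₀).mono_left nhdsWithin_le_nhds
  have hnear : ∀ᶠ s in 𝓝[I] t₀, ‖G s - G t₀‖ ≤ 2 * L * (2 * ‖G t₀‖) * |s - t₀| :=
    Filter.mem_of_superset (inter_mem_nhdsWithin I (Metric.ball_mem_nhds t₀ hδ)) hlip
  exact tendsto_of_norm_sub_le (E := V →L[ℝ] V →L[ℝ] ℝ) hnear hlim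

/-- Product rule in which a factor vanishing at the base point needs to be multiplied only by
continuous terms. -/
theorem HasDerivWithinAt.clm_apply₂_of_eq_zero_right {S : Set ℝ} {t : ℝ}
    {G : ℝ → V →L[ℝ] V →L[ℝ] ℝ} {a b : ℝ → V} {b' : V}
    (hG : ContinuousWithinAt G S t) (ha : ContinuousWithinAt a S t)
    (hb : HasDerivWithinAt b b' S t) (hbt : b t = 0) :
    HasDerivWithinAt (fun s => G s (a s) (b s)) (G t (a t) b') S t := by
  rw [hasDerivWithinAt_iff_tendsto_slope] at hb ⊢
  have hGa : ContinuousWithinAt (fun s => G s (a s)) S t := hG.clm_apply ha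
  have := (isBoundedBilinearMap_apply (𝕜 := ℝ) (E := V) (F := ℝ)).continuous.tendsto
    (G t (a t), b') |>.comp
      ((hGa.tendsto.mono_left (nhdsWithin_mono t Set.sdiff_subset)).prodMk_nhds hb)
  refine this.congr fun s => ?_
  simp [slope_def_module, hbt]

/-- Product rule for `s ↦ G s (a s) (b s)` when `G` is norm continuous and differentiable
pointwise. -/
theorem HasDerivWithinAt.clm_apply₂_of_pointwise {S : Set ℝ} {t : ℝ}
    {G : ℝ → V →L[ℝ] V →L[ℝ] ℝ} {a b : ℝ → V} {a' b' : V} {d : ℝ}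
    (hG : ContinuousWithinAt G S t)
    (hd : HasDerivWithinAt (fun s => G s (a t) (b t)) d S t)
    (ha : HasDerivWithinAt a a' S t) (hb : HasDerivWithinAt b b' S t) :
    HasDerivWithinAt (fun s => G s (a s) (b s)) (d + G t a' (b t) + G t (a t) b') S t := by
  have hflip : ContinuousWithinAt (fun s => (G s).flip) S t :=
    (ContinuousLinearMap.flipₗᵢ ℝ V V ℝ).continuous.continuousAt.comp_continuousWithinAt hG
  have h1 := HasDerivWithinAt.clm_apply₂_of_eq_zero_right hflip
    (continuousWithinAt_const (b := b t)) (ha.sub_const (a t)) (sub_self _)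
  have h2 := HasDerivWithinAt.clm_apply₂_of_eq_zero_right hG ha.continuousWithinAt
    (hb.sub_const (b t)) (sub_self _)
  refine ((hd.add h1).add h2).congr_deriv (by simp) |>.congr (fun s _ => ?_) ?_ <;> simp

end ParallelForm

/-- Let `x` be a `C²` geodesic on the (nondegenerate) interval `I`,
`ξ ∈ C¹(I, V)` and `τ ∈ I`.  Let `H` be a collection of Jacobi fields `η` along `x`
(recorded as triples `(η, η', J)` of the field, its derivative and its domain
`J ⊆ I`, a neighborhood of `τ` in `I`), each vanishing at `τ`, such that
`{η'(τ) : η ∈ H}` is dense in `V`.  Then for each `η ∈ H` the function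
`t ↦ g_{x t}(ξ t, η t)` is twice differentiable at `τ`, and `D_{x′}ξ(τ) = 0` holds iff
`(d²/dt²) g_{x t}(ξ t, η t)|_{t=τ} = 0` for all `η ∈ H`. -/
theorem statement19 {V : Type*} [NormedAddCommGroup V] [NormedSpace ℝ V]
    (Ω : Set V) (hΩ : IsOpen Ω)
    (g : V → V →L[ℝ] V →L[ℝ] ℝ) (hg : IsRiemannianMetric Ω g)
    (A : V → V →L[ℝ] V →L[ℝ] V) (hA1 : ContDiffOn ℝ 1 A Ω) (hALC : IsLeviCivita Ω g A)
    (I : Set ℝ) (hI : I.OrdConnected) (hne : ∃ a ∈ I, ∃ b ∈ I, a < b)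
    (x x' x'' : ℝ → V) (hmem : ∀ t ∈ I, x t ∈ Ω)
    (hx : ∀ t ∈ I, HasDerivWithinAt x (x' t) I t)
    (hx' : ∀ t ∈ I, HasDerivWithinAt x' (x'' t) I t)
    (hx''c : ContinuousOn x'' I)
    (hgeo : ∀ t ∈ I, x'' t + A (x t) (x' t) (x' t) = 0)
    (ξ ξ' : ℝ → V)
    (hξ : ∀ t ∈ I, HasDerivWithinAt ξ (ξ' t) I t) (hξ'c : ContinuousOn ξ' I)
    (τ : ℝ) (hτ : τ ∈ I)
    (H : Set ((ℝ → V) × (ℝ → V) × Set ℝ))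
    (hH : ∀ p ∈ H,
      p.2.2 ⊆ I ∧ p.2.2 ∈ 𝓝[I] τ ∧
      (∀ t ∈ p.2.2, HasDerivWithinAt p.1 (p.2.1 t) p.2.2 t) ∧
      ContinuousOn p.2.1 p.2.2 ∧
      p.1 τ = 0 ∧
      ∃ η'' : ℝ → V,
        (∀ t ∈ p.2.2, HasDerivWithinAt p.2.1 (η'' t) p.2.2 t) ∧
        ContinuousOn η'' p.2.2 ∧
        ∃ ψ' : ℝ → V,
          (∀ t ∈ p.2.2, HasDerivWithinAt
            (fun t => p.2.1 t + A (x t) (x' t) (p.1 t)) (ψ' t) p.2.2 t) ∧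
          ∀ t ∈ p.2.2,
            ψ' t + A (x t) (x' t) (p.2.1 t + A (x t) (x' t) (p.1 t)) =
              curvature A (x t) (x' t) (p.1 t) (x' t))
    (hdense : Dense ((fun p : (ℝ → V) × (ℝ → V) × Set ℝ => p.2.1 τ) '' H)) :
    (∀ p ∈ H, ∃ h' : ℝ → ℝ, ∃ c : ℝ,
      (∀ t ∈ p.2.2, HasDerivWithinAt (fun t => g (x t) (ξ t) (p.1 t)) (h' t) p.2.2 t) ∧
      HasDerivWithinAt h' c p.2.2 τ) ∧
    (ξ' τ + A (x τ) (x' τ) (ξ τ) = 0 ↔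
      ∀ p ∈ H, ∀ h' : ℝ → ℝ, ∀ c : ℝ,
        (∀ t ∈ p.2.2, HasDerivWithinAt (fun t => g (x t) (ξ t) (p.1 t)) (h' t) p.2.2 t) →
        HasDerivWithinAt h' c p.2.2 τ → c = 0) := by
  set G : ℝ → V →L[ℝ] V →L[ℝ] ℝ := fun t => g (x t) with hGdef
  set B : ℝ → V →L[ℝ] V := fun t => A (x t) (x' t) with hBdef
  have hBc : ContinuousOn B I :=
    (hA1.continuousOn.comp (fun t ht => (hx t ht).continuousWithinAt) hmem).clm_apply
      fun t ht => (hx' t ht).continuousWithinAt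
  have hGd : ∀ t ∈ I, ∀ η ζ : V, HasDerivWithinAt (fun s => G s η ζ)
      (G t (B t η) ζ + G t η (B t ζ)) I t := fun t ht η ζ =>
    (hALC.2 (x t) (hmem t ht) η ζ).comp_hasDerivWithinAt t (hx t ht)
  have hGc : ContinuousOn G I := continuousOn_of_pointwise_hasDerivWithinAt hI hBc hGd
  have huI : UniqueDiffOn ℝ I := by
    obtain ⟨a, ha, b, hb, hab⟩ := hne
    refine uniqueDiffOn_convex hI.convex ?_
    have : Set.Ioo a b ⊆ interior I :=
      interior_maximal (Set.Ioo_subset_Icc_self.trans (hI.out ha hb)) isOpen_Ioo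
    exact (Set.nonempty_Ioo.2 hab).mono this
  have hprod : ∀ {J : Set ℝ}, J ⊆ I → ∀ t ∈ J, ∀ {b : ℝ → V} {b' : V},
      HasDerivWithinAt b b' J t →
      HasDerivWithinAt (fun s => G s (ξ s) (b s))
        (G t (ξ' t + B t (ξ t)) (b t) + G t (ξ t) (b' + B t (b t))) J t := by
    intro J hJ t ht b b' hb
    refine (HasDerivWithinAt.clm_apply₂_of_pointwise ((hGc t (hJ ht)).mono hJ)
      ((hGd t (hJ ht) _ _).mono hJ) ((hξ t (hJ ht)).mono hJ) hb).congr_deriv ?_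
    simp only [map_add, add_apply]
    ring
  have hmain : ∀ p ∈ H, ∃ h' : ℝ → ℝ,
      (∀ t ∈ p.2.2, HasDerivWithinAt (fun t => g (x t) (ξ t) (p.1 t)) (h' t) p.2.2 t) ∧
      HasDerivWithinAt h' (2 * G τ (ξ' τ + B τ (ξ τ)) (p.2.1 τ)) p.2.2 τ := by
    intro p hp
    obtain ⟨hJI, hJ, hη, -, hη0, -, -, -, ψ', hψ, hjac⟩ := hH p hp
    have hτJ : τ ∈ p.2.2 := mem_of_mem_nhdsWithin hτ hJ
    refine ⟨fun t => G t (ξ' t + B t (ξ t)) (p.1 t) + G t (ξ t) (p.2.1 t + B t (p.1 t)),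
      fun t ht => hprod hJI t ht (hη t ht), ?_⟩
    have hζ : ContinuousWithinAt (fun t => ξ' t + B t (ξ t)) p.2.2 τ :=
      ((hξ'c τ hτ).add ((hBc τ hτ).clm_apply (hξ τ hτ).continuousWithinAt)).mono hJI
    have h1 := HasDerivWithinAt.clm_apply₂_of_eq_zero_right ((hGc τ hτ).mono hJI) hζ
      (hη τ hτJ) hη0
    have h2 := hprod hJI τ hτJ (hψ τ hτJ)
    refine (h1.add h2).congr_deriv ?_
    have h3 : ψ' τ + B τ (p.2.1 τ + B τ (p.1 τ)) = 0 := by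
      rw [hjac τ hτJ, hη0]
      simp [curvature]
    rw [h3, hη0]
    simp only [map_zero, add_zero]
    ring
  have huniq : ∀ p ∈ H, ∀ h' : ℝ → ℝ, ∀ c : ℝ,
      (∀ t ∈ p.2.2, HasDerivWithinAt (fun t => g (x t) (ξ t) (p.1 t)) (h' t) p.2.2 t) →
      HasDerivWithinAt h' c p.2.2 τ → c = 2 * G τ (ξ' τ + B τ (ξ τ)) (p.2.1 τ) := by
    intro p hp h' c hh' hc
    obtain ⟨k', hk', hk⟩ := hmain p hp
    obtain ⟨hJI, hJ, -⟩ := hH p hp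
    have hτJ : τ ∈ p.2.2 := mem_of_mem_nhdsWithin hτ hJ
    have hev : ∀ᶠ t in 𝓝[p.2.2] τ, h' t = k' t := by
      have h1 : ∀ᶠ t in 𝓝[I] τ, p.2.2 ∈ 𝓝[I] t := eventually_eventually_nhdsWithin.2 hJ
      filter_upwards [h1.filter_mono (nhdsWithin_mono τ hJI), self_mem_nhdsWithin] with t ht htJ
      exact UniqueDiffWithinAt.eq_deriv _
        ((huI t (hJI htJ)).mono_nhds (nhdsWithin_le_iff.2 ht)) (hh' t htJ) (hk' t htJ)
    refine UniqueDiffWithinAt.eq_deriv _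
      ((huI τ hτ).mono_nhds (nhdsWithin_le_iff.2 hJ)) hc ?_
    exact hk.congr_of_eventuallyEq hev (hev.self_of_nhdsWithin hτJ)
  refine ⟨fun p hp => ?_, fun h0 p hp h' c hh' hc => ?_, fun h0 => ?_⟩
  · obtain ⟨h', h1, h2⟩ := hmain p hp
    exact ⟨h', _, h1, h2⟩
  · rw [huniq p hp h' c hh' hc, show ξ' τ + B τ (ξ τ) = 0 from h0]
    simp
  · by_contra hne0
    have hzero : G τ (ξ' τ + B τ (ξ τ)) = 0 := by
      refine DFunLike.coe_injective (Continuous.ext_on hdense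
        (ContinuousLinearMap.continuous _) (ContinuousLinearMap.continuous _) ?_)
      rintro _ ⟨p, hp, rfl⟩
      obtain ⟨h', h1, h2⟩ := hmain p hp
      simpa using h0 p hp h' _ h1 h2
    have := hg.2 (x τ) (hmem τ hτ) _ hne0
    exact this.ne' (DFunLike.congr_fun hzero _)
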